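/- Given a set of clusters C on a finite taxa set X, there exists a maximal ST-set tree sequence (S_1, S_2, ..., S_p) of C such that p ≤ r(C). -/

import Mathlib

open scoped Classical

namespace Phylo

variable {α : Type} [DecidableEq α]

/-- A finite directed graph whose vertices carry labels from `α`; used to model
rooted phylogenetic networks and trees. -/
structure Net (α : Type) where
  n : ℕ
  E : Finset (Fin n × Fin n)
  label : Fin n → α

namespace Net

def indeg (N : Net α) (v : Fin N.n) : ℕ := (N.E.filter fun e => e.2 = v).card

def outdeg (N : Net α) (v : Fin N.n) : ℕ := (N.E.filter fun e => e.1 = v).card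

def Adj (N : Net α) (u v : Fin N.n) : Prop := (u, v) ∈ N.E

def Reaches (N : Net α) : Fin N.n → Fin N.n → Prop := Relation.ReflTransGen N.Adj

def IsLeaf (N : Net α) (v : Fin N.n) : Prop := N.outdeg v = 0

/-- The set of labels of leaves reachable from `v` by directed paths. -/
noncomputable def clusterBelow (N : Net α) (v : Fin N.n) : Finset α :=
  (Finset.univ.filter fun w => N.Reaches v w ∧ N.IsLeaf w).image N.label

/-- The reticulation number `r(N) = Σ_{v : indeg(v) > 0} (indeg(v) - 1)`. -/
def reticNum (N : Net α) : ℕ := ∑ v, (N.indeg v - 1)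

end Net

/-- `N` is a rooted phylogenetic network on the taxa set `X`: an acyclic digraph with a
unique root (indegree-0 node), no node with indegree 1 and outdegree 1, every
reticulation (indegree ≥ 2) having outdegree ≥ 1, and leaves bijectively labeled by `X`. -/
def IsPhyloNet (X : Finset α) (N : Net α) : Prop :=
  (∀ v : Fin N.n, ¬ Relation.TransGen N.Adj v v) ∧
  (∃! ρ : Fin N.n, N.indeg ρ = 0) ∧
  (∀ v : Fin N.n, ¬ (N.indeg v = 1 ∧ N.outdeg v = 1)) ∧
  (∀ v : Fin N.n, 2 ≤ N.indeg v → 1 ≤ N.outdeg v) ∧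
  Set.BijOn N.label {v | N.IsLeaf v} (X : Set α)

/-- A rooted phylogenetic tree on `X` is a network on `X` with reticulation number 0. -/
def IsPhyloTree (X : Finset α) (N : Net α) : Prop := IsPhyloNet X N ∧ N.reticNum = 0

/-- A network is binary if every reticulation has indegree 2 and outdegree 1 and every
non-leaf tree node has outdegree 2. -/
def IsBinary (N : Net α) : Prop :=
  ∀ v : Fin N.n, (N.indeg v ≤ 1 → N.outdeg v = 0 ∨ N.outdeg v = 2) ∧
    (2 ≤ N.indeg v → N.indeg v = 2 ∧ N.outdeg v = 1)

/-- The internal vertices of a path given as a list of vertices. -/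
def internals {β : Type*} (p : List β) : List β := p.tail.dropLast

def IsDirPath (N : Net α) (u v : Fin N.n) (p : List (Fin N.n)) : Prop :=
  p.head? = some u ∧ p.getLast? = some v ∧ p.Chain' N.Adj ∧ 2 ≤ p.length

/-- `N` displays `T`: `T` can be obtained from `N` by deleting nodes and edges and
suppressing indegree-1 outdegree-1 nodes, formalized as a topological embedding:
each edge of `T` maps to a directed path of `N`, paths being internally disjoint
from each other and from the images of the nodes of `T`, and leaves of `T` map to
leaves of `N` with the same label. -/
def Displays (N T : Net α) : Prop :=
  ∃ φ : Fin T.n → Fin N.n, Function.Injective φ ∧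
    (∀ v, T.IsLeaf v → N.IsLeaf (φ v) ∧ N.label (φ v) = T.label v) ∧
    ∃ P : Fin T.n × Fin T.n → List (Fin N.n),
      (∀ e ∈ T.E, IsDirPath N (φ e.1) (φ e.2) (P e)) ∧
      (∀ e ∈ T.E, ∀ w ∈ internals (P e), w ∉ Set.range φ) ∧
      (∀ e ∈ T.E, ∀ f ∈ T.E, e ≠ f → ∀ w ∈ internals (P e), w ∉ internals (P f))

/-- `N` represents the cluster `C` in the softwired sense: some tree on `X` displayed by
`N` has an edge whose set of leaf descendants is exactly `C`. -/
def RepresentsCluster (X : Finset α) (N : Net α) (C : Finset α) : Prop :=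
  ∃ T : Net α, IsPhyloTree X T ∧ Displays N T ∧ ∃ e ∈ T.E, T.clusterBelow e.2 = C

def RepresentsSet (X : Finset α) (N : Net α) (𝒞 : Set (Finset α)) : Prop :=
  ∀ C ∈ 𝒞, RepresentsCluster X N C

/-- `Cl(T)`: the set of clusters represented by edges of the tree `T`. -/
def clSet (T : Net α) : Set (Finset α) := {C | ∃ e ∈ T.E, T.clusterBelow e.2 = C}

/-- `r(𝒞)`: the minimum reticulation number of a network on `X` representing `𝒞`. -/
noncomputable def rNum (X : Finset α) (𝒞 : Set (Finset α)) : ℕ :=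
  sInf {k | ∃ N : Net α, IsPhyloNet X N ∧ RepresentsSet X N 𝒞 ∧ N.reticNum = k}

/-- A cluster on `X` is a nonempty proper subset of `X`. -/
def IsCluster (X C : Finset α) : Prop := C ⊆ X ∧ C.Nonempty ∧ C ≠ X

def IsClusterSet (X : Finset α) (𝒞 : Set (Finset α)) : Prop := ∀ C ∈ 𝒞, IsCluster X C

def Compatible (A B : Finset α) : Prop := A ∩ B = ∅ ∨ A ⊆ B ∨ B ⊆ A

/-- `𝒞 \ S`: remove the elements of `S` from each cluster, discarding emptied clusters. -/
def removeTaxa (𝒞 : Set (Finset α)) (S : Finset α) : Set (Finset α) :=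
  {D | D.Nonempty ∧ ∃ C ∈ 𝒞, D = C \ S}

/-- `𝒞 | S`: the restriction of `𝒞` to `S`. -/
def restrictTo (𝒞 : Set (Finset α)) (S : Finset α) : Set (Finset α) :=
  {D | D.Nonempty ∧ ∃ C ∈ 𝒞, D = C ∩ S}

/-- `S` is unseparated by `𝒞`: no cluster of `𝒞` is incompatible with `S`. -/
def Unseparated (𝒞 : Set (Finset α)) (S : Finset α) : Prop := ∀ C ∈ 𝒞, Compatible C S

/-- `𝒞` separates every proper subset of `X` with at least two elements. -/
def Separating (X : Finset α) (𝒞 : Set (Finset α)) : Prop :=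
  ∀ X' : Finset α, X' ⊂ X → 2 ≤ X'.card → ∃ C ∈ 𝒞, ¬ Compatible C X'

def PairwiseCompatible (𝒞 : Set (Finset α)) : Prop := ∀ A ∈ 𝒞, ∀ B ∈ 𝒞, Compatible A B

/-- `S` is an ST-set with respect to `𝒞`. -/
def IsSTSet (X : Finset α) (𝒞 : Set (Finset α)) (S : Finset α) : Prop :=
  S ⊆ X ∧ Unseparated 𝒞 S ∧ PairwiseCompatible (restrictTo 𝒞 S)

/-- `S` is a maximal ST-set: no ST-set properly contains it. -/
def IsMaxSTSet (X : Finset α) (𝒞 : Set (Finset α)) (S : Finset α) : Prop :=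
  IsSTSet X 𝒞 S ∧ ∀ S', IsSTSet X 𝒞 S' → ¬ S ⊂ S'

/-- `(S₁, …, S_p)` is a maximal ST-set sequence of `𝒞`. -/
def IsMaxSTSeq : Finset α → Set (Finset α) → List (Finset α) → Prop
  | _, _, [] => True
  | X, 𝒞, S :: L => IsMaxSTSet X 𝒞 S ∧ IsMaxSTSeq (X \ S) (removeTaxa 𝒞 S) L

/-- `(S₁, …, S_p)` is an ST-set sequence of `𝒞` (empty ST-sets allowed). -/
def IsSTSeq : Finset α → Set (Finset α) → List (Finset α) → Prop
  | _, _, [] => True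
  | X, 𝒞, S :: L => IsSTSet X 𝒞 S ∧ IsSTSeq (X \ S) (removeTaxa 𝒞 S) L

def removeAll (𝒞 : Set (Finset α)) (L : List (Finset α)) : Set (Finset α) :=
  L.foldl removeTaxa 𝒞

/-- A maximal ST-set *tree* sequence: additionally the remaining clusters are pairwise
compatible. -/
def IsMaxSTTreeSeq (X : Finset α) (𝒞 : Set (Finset α)) (L : List (Finset α)) : Prop :=
  IsMaxSTSeq X 𝒞 L ∧ PairwiseCompatible (removeAll 𝒞 L)

def IsSTTreeSeq (X : Finset α) (𝒞 : Set (Finset α)) (L : List (Finset α)) : Prop :=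
  IsSTSeq X 𝒞 L ∧ PairwiseCompatible (removeAll 𝒞 L)

/-- The MST lower bound: minimum length of a maximal ST-set tree sequence of `𝒞`. -/
noncomputable def mstLB (X : Finset α) (𝒞 : Set (Finset α)) : ℕ :=
  sInf {p | ∃ L, IsMaxSTTreeSeq X 𝒞 L ∧ L.length = p}

/- Underlying undirected notions, biconnected components and the level of a network. -/

def uadj (N : Net α) (F : Finset (Fin N.n × Fin N.n)) (u v : Fin N.n) : Prop :=
  (u, v) ∈ F ∨ (v, u) ∈ F

def verts (N : Net α) (F : Finset (Fin N.n × Fin N.n)) : Finset (Fin N.n) :=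
  F.image Prod.fst ∪ F.image Prod.snd

def ConnOn (N : Net α) (F : Finset (Fin N.n × Fin N.n)) : Prop :=
  ∀ u ∈ verts N F, ∀ v ∈ verts N F, Relation.ReflTransGen (uadj N F) u v

def delVert (N : Net α) (F : Finset (Fin N.n × Fin N.n)) (v : Fin N.n) :
    Finset (Fin N.n × Fin N.n) :=
  F.filter fun e => e.1 ≠ v ∧ e.2 ≠ v

def HasCutNodeOn (N : Net α) (F : Finset (Fin N.n × Fin N.n)) : Prop :=
  ∃ v ∈ verts N F, ∃ a ∈ verts N F, ∃ b ∈ verts N F, a ≠ v ∧ b ≠ v ∧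
    ¬ Relation.ReflTransGen (uadj N (delVert N F v)) a b

/-- The (edge set of a) subgraph is biconnected: connected and without cut-nodes. -/
def Biconn (N : Net α) (F : Finset (Fin N.n × Fin N.n)) : Prop :=
  F.Nonempty ∧ ConnOn N F ∧ ¬ HasCutNodeOn N F

/-- `F` is a biconnected component of `N`: a maximal biconnected subgraph. -/
def IsBCC (N : Net α) (F : Finset (Fin N.n × Fin N.n)) : Prop :=
  F ⊆ N.E ∧ Biconn N F ∧ ∀ F', F' ⊆ N.E → Biconn N F' → F ⊆ F' → F' = F

/-- Reticulation number of a biconnected component, indegrees computed within it. -/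
def compRetic (N : Net α) (F : Finset (Fin N.n × Fin N.n)) : ℕ :=
  ∑ v ∈ verts N F, ((F.filter fun e => e.2 = v).card - 1)

/-- The level of `N`: the maximum reticulation number of a biconnected component. -/
noncomputable def level (N : Net α) : ℕ :=
  sSup {k | ∃ F, IsBCC N F ∧ compRetic N F = k}

def IsCutEdge (N : Net α) (e : Fin N.n × Fin N.n) : Prop :=
  e ∈ N.E ∧ ∃ a b : Fin N.n, ¬ Relation.ReflTransGen (uadj N (N.E.erase e)) a b

def IsCutNode (N : Net α) (v : Fin N.n) : Prop :=
  ∃ a b : Fin N.n, a ≠ v ∧ b ≠ v ∧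
    ¬ Relation.ReflTransGen (uadj N (delVert N N.E v)) a b

/-- `N` is simple: removal of any cut-node or cut-edge leaves at most one non-trivial
connected component (all remaining edges lie in a single component). -/
def IsSimpleNet (N : Net α) : Prop :=
  (∀ v : Fin N.n, IsCutNode N v → ∀ f ∈ delVert N N.E v, ∀ g ∈ delVert N N.E v,
      Relation.ReflTransGen (uadj N (delVert N N.E v)) f.1 g.1) ∧
  (∀ e : Fin N.n × Fin N.n, IsCutEdge N e → ∀ f ∈ N.E.erase e, ∀ g ∈ N.E.erase e,
      Relation.ReflTransGen (uadj N (N.E.erase e)) f.1 g.1)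

/-- The non-trivial ST-set `S` is under a cut-edge of `N`: `N` has a cut-edge `(u,v)`
such that the subnetwork rooted at `v` is a tree whose taxa set is `S` and which
represents the cluster set `𝒞 | S`. -/
def UnderCutEdge (𝒞 : Set (Finset α)) (N : Net α) (S : Finset α) : Prop :=
  ∃ e ∈ N.E, IsCutEdge N e ∧ N.clusterBelow e.2 = S ∧
    (∀ w : Fin N.n, N.Reaches e.2 w →
      (N.E.filter fun f => f.2 = w ∧ N.Reaches e.2 f.1).card ≤ 1) ∧
    ∀ C ∈ restrictTo 𝒞 S, ∃ f ∈ N.E, N.Reaches e.2 f.1 ∧ N.clusterBelow f.2 = C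

/-- The subnetwork of `N` rooted at `v` is exactly (isomorphic to) `T`. -/
def IsoSubnetAt (N : Net α) (v : Fin N.n) (T : Net α) : Prop :=
  ∃ g : Fin T.n → Fin N.n, Function.Injective g ∧
    Set.range g = {w | N.Reaches v w} ∧
    (∀ a b : Fin T.n, (a, b) ∈ T.E ↔ (g a, g b) ∈ N.E) ∧
    ∀ a : Fin T.n, T.IsLeaf a → N.label (g a) = T.label a

/-- `T` is a subtree below a reticulation (SBR) of `N`. -/
def IsSBR (N T : Net α) : Prop :=
  ∃ v : Fin N.n, 2 ≤ N.indeg v ∧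
    (∀ w : Fin N.n, N.Reaches v w → w ≠ v → N.indeg w < 2) ∧
    ((N.outdeg v = 1 ∧ ∃ c : Fin N.n, (v, c) ∈ N.E ∧ IsoSubnetAt N c T) ∨
     (N.outdeg v ≠ 1 ∧ IsoSubnetAt N v T))

/-- `T'` is a (not necessarily binary) refinement of `T`: a tree on `X` with
`Cl(T) ⊆ Cl(T')`. -/
def IsRefinement (X : Finset α) (T T' : Net α) : Prop :=
  IsPhyloTree X T' ∧ clSet T ⊆ clSet T'

/-- `h⁰(𝒯)`: minimum reticulation number of a network on `X` displaying some
refinement of each tree of the family. -/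
noncomputable def h0 (X : Finset α) {m : ℕ} (T : Fin m → Net α) : ℕ :=
  sInf {k | ∃ N : Net α, IsPhyloNet X N ∧
    (∀ i, ∃ T', IsRefinement X (T i) T' ∧ Displays N T') ∧ N.reticNum = k}

/-- `h⁻(𝒯)`: minimum reticulation number of a network on `X` displaying some *binary*
refinement of each tree of the family. -/
noncomputable def hminus (X : Finset α) {m : ℕ} (T : Fin m → Net α) : ℕ :=
  sInf {k | ∃ N : Net α, IsPhyloNet X N ∧
    (∀ i, ∃ T', IsRefinement X (T i) T' ∧ IsBinary T' ∧ Displays N T') ∧ N.reticNum = k}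

/-- `N` is consistent with the rooted triplet `xy|z`: it displays the binary tree on
`{x,y,z}` in which `{x,y}` is a cluster. -/
def ConsistentTriplet (N : Net α) (x y z : α) : Prop :=
  ∃ t : Net α, IsPhyloTree ({x, y, z} : Finset α) t ∧ IsBinary t ∧
    (∃ e ∈ t.E, t.clusterBelow e.2 = ({x, y} : Finset α)) ∧ Displays N t

/-- `r_tr(𝒯)`: minimum reticulation number of a network on `X` consistent with every
rooted triplet consistent with some tree of the family. -/
noncomputable def rtr (X : Finset α) {m : ℕ} (T : Fin m → Net α) : ℕ :=
  sInf {k | ∃ N : Net α, IsPhyloNet X N ∧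
    (∀ x y z : α, x ≠ y → y ≠ z → x ≠ z →
      (∃ i, ConsistentTriplet (T i) x y z) → ConsistentTriplet N x y z) ∧
    N.reticNum = k}

/-- `𝒞_{U → u}`: replace all elements of `U` in every cluster by the single taxon `u`. -/
def collapseTo (𝒞 : Set (Finset α)) (U : Finset α) (u : α) : Set (Finset α) :=
  {D | ∃ C ∈ 𝒞, D = if (C ∩ U).Nonempty then (C \ U) ∪ {u} else C}

set_option linter.unusedSectionVars false

/-! Set-theoretic part: from ST-set sequences to maximal ST-set sequences. -/

lemma compatible_sdiff {A B : Finset α} (Z : Finset α) (h : Compatible A B) :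
    Compatible (A \ Z) (B \ Z) := by
  rcases h with h | h | h
  · left
    ext x
    have := Finset.ext_iff.1 h x
    simp at this ⊢
    tauto
  · right; left; exact Finset.sdiff_subset_sdiff h (le_refl _)
  · right; right; exact Finset.sdiff_subset_sdiff h (le_refl _)

lemma removeTaxa_removeTaxa (𝒞 : Set (Finset α)) (S T : Finset α) :
    removeTaxa (removeTaxa 𝒞 S) T = removeTaxa 𝒞 (S ∪ T) := by
  ext D
  constructor
  · rintro ⟨hD, C, ⟨hC, B, hB, rfl⟩, rfl⟩
    exact ⟨hD, B, hB, by rw [sdiff_sdiff_left]; rfl⟩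
  · rintro ⟨hD, B, hB, rfl⟩
    have e : B \ (S ∪ T) = (B \ S) \ T := by rw [sdiff_sdiff_left]; rfl
    rw [e] at hD ⊢
    exact ⟨hD, B \ S, ⟨hD.mono Finset.sdiff_subset, B, hB, rfl⟩, rfl⟩

lemma pc_removeTaxa {𝒞 : Set (Finset α)} (Z : Finset α) (h : PairwiseCompatible 𝒞) :
    PairwiseCompatible (removeTaxa 𝒞 Z) := by
  rintro A ⟨-, A, hA, rfl⟩ B ⟨-, B, hB, rfl⟩
  exact compatible_sdiff Z (h A hA B hB)

lemma isSTSet_sdiff {X : Finset α} {𝒞 : Set (Finset α)} {S : Finset α} (Z : Finset α)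
    (h : IsSTSet X 𝒞 S) : IsSTSet (X \ Z) (removeTaxa 𝒞 Z) (S \ Z) := by
  obtain ⟨h1, h2, h3⟩ := h
  refine ⟨Finset.sdiff_subset_sdiff h1 (le_refl _), ?_, ?_⟩
  · rintro C ⟨-, C, hC, rfl⟩
    exact compatible_sdiff Z (h2 C hC)
  · have key : ∀ C : Finset α, (C \ Z) ∩ (S \ Z) = (C ∩ S) \ Z := by
      intro C; ext x; simp; tauto
    rintro A ⟨hA0, A, ⟨-, A, hA, rfl⟩, rfl⟩ B ⟨hB0, B, ⟨-, B, hB, rfl⟩, rfl⟩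
    rw [key] at hA0 hB0 ⊢
    rw [key]
    exact compatible_sdiff Z (h3 _ ⟨hA0.mono Finset.sdiff_subset, A, hA, rfl⟩ _
      ⟨hB0.mono Finset.sdiff_subset, B, hB, rfl⟩)

lemma isSTTreeSeq_sdiff (Z : Finset α) (L : List (Finset α)) :
    ∀ (X : Finset α) (𝒞 : Set (Finset α)), IsSTTreeSeq X 𝒞 L →
      IsSTTreeSeq (X \ Z) (removeTaxa 𝒞 Z) (L.map (· \ Z)) := by
  induction L with
  | nil =>
    rintro X 𝒞 ⟨-, h⟩
    exact ⟨trivial, pc_removeTaxa Z h⟩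
  | cons S L ih =>
    rintro X 𝒞 ⟨⟨h1, h2⟩, h3⟩
    obtain ⟨g1, g2⟩ := ih (X \ S) (removeTaxa 𝒞 S) ⟨h2, h3⟩
    have e1 : (X \ S) \ Z = (X \ Z) \ (S \ Z) := by ext x; simp; tauto
    have e2 : removeTaxa (removeTaxa 𝒞 S) Z = removeTaxa (removeTaxa 𝒞 Z) (S \ Z) := by
      rw [removeTaxa_removeTaxa, removeTaxa_removeTaxa]
      congr 1; ext x; simp; tauto
    rw [e1, e2] at g1
    rw [e2] at g2
    exact ⟨⟨isSTSet_sdiff Z h1, g1⟩, g2⟩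

lemma exists_max_of_st {X : Finset α} {𝒞 : Set (Finset α)} {S : Finset α}
    (h : IsSTSet X 𝒞 S) : ∃ M, S ⊆ M ∧ IsMaxSTSet X 𝒞 M := by
  obtain ⟨M, hM, hmax⟩ := Finset.exists_max_image
    (X.powerset.filter fun M => S ⊆ M ∧ IsSTSet X 𝒞 M) Finset.card
    ⟨S, by simp [h, h.1]⟩
  simp only [Finset.mem_filter, Finset.mem_powerset] at hM hmax
  refine ⟨M, hM.2.1, hM.2.2, fun S' hS' hlt => ?_⟩
  have := hmax S' ⟨hS'.1, hM.2.1.trans hlt.subset, hS'⟩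
  have := Finset.card_lt_card hlt
  omega

lemma exists_max_seq (p : ℕ) : ∀ (L : List (Finset α)) (X : Finset α) (𝒞 : Set (Finset α)),
    L.length = p → IsSTTreeSeq X 𝒞 L → ∃ M, IsMaxSTTreeSeq X 𝒞 M ∧ M.length ≤ p := by
  induction p with
  | zero =>
    intro L X 𝒞 hL h
    obtain rfl := List.length_eq_zero_iff.1 hL
    exact ⟨[], ⟨trivial, h.2⟩, le_refl _⟩
  | succ p ih =>
    intro L X 𝒞 hL h
    match L, hL, h with
    | S :: L, hL, h =>
      obtain ⟨⟨h1, h2⟩, h3⟩ := h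
      obtain ⟨M, hSM, hM⟩ := exists_max_of_st h1
      have g := isSTTreeSeq_sdiff M L (X \ S) (removeTaxa 𝒞 S) ⟨h2, h3⟩
      have e1 : (X \ S) \ M = X \ M := by
        ext x
        have := @hSM x
        simp; tauto
      rw [e1, removeTaxa_removeTaxa, Finset.union_eq_right.2 hSM] at g
      obtain ⟨L', hL', hlen⟩ := ih _ _ _ (by simpa using hL) g
      exact ⟨M :: L', ⟨⟨hM, hL'.1⟩, hL'.2⟩, by simpa using hlen⟩

/-! Softwired clusters via parent functions. -/

/-- `u` is an ancestor of `w` for the parent function `p`. -/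
def Anc {V : Type} (p : V → V) (u w : V) : Prop := ∃ k, p^[k] w = u

lemma Anc.refl {V : Type} (p : V → V) (u : V) : Anc p u u := ⟨0, rfl⟩

lemma Anc.trans {V : Type} {p : V → V} {u v w : V} (h : Anc p u v) (h' : Anc p v w) :
    Anc p u w := by
  obtain ⟨k, rfl⟩ := h
  obtain ⟨l, rfl⟩ := h'
  exact ⟨k + l, Function.iterate_add_apply p k l w⟩

lemma Anc.step {V : Type} (p : V → V) (w : V) : Anc p (p w) w := ⟨1, rfl⟩

lemma Anc.eq_or {V : Type} {p : V → V} {u w : V} (h : Anc p u w) : w = u ∨ Anc p u (p w) := by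
  obtain ⟨k, rfl⟩ := h
  cases k with
  | zero => left; rfl
  | succ k => right; exact ⟨k, rfl⟩

/-- `p` chooses a parent for every non-root node of `N`. -/
def IsPar (N : Net α) (p : Fin N.n → Fin N.n) : Prop :=
  ∀ v, N.Adj (p v) v ∨ p v = v

def GoodPar (N : Net α) (p : Fin N.n → Fin N.n) : Prop :=
  IsPar N p ∧ ∀ v, N.indeg v ≠ 0 → N.Adj (p v) v

lemma IsPar.reaches {N : Net α} {p : Fin N.n → Fin N.n} (hp : IsPar N p) {u w : Fin N.n}
    (h : Anc p u w) : N.Reaches u w := by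
  obtain ⟨k, rfl⟩ := h
  induction k with
  | zero => exact .refl
  | succ k ih =>
    rw [Function.iterate_succ_apply']
    rcases hp (p^[k] w) with h | h
    · exact Relation.ReflTransGen.head h ih
    · rw [h]; exact ih

def Rep (N : Net α) (C : Finset α) : Prop :=
  ∃ p u, GoodPar N p ∧ ∀ w, N.IsLeaf w → (N.label w ∈ C ↔ Anc p u w)

lemma adj_indeg {N : Net α} {u v : Fin N.n} (h : N.Adj u v) : N.indeg v ≠ 0 := by
  unfold Net.indeg
  rw [← Nat.pos_iff_ne_zero, Finset.card_pos]
  exact ⟨(u, v), by simpa [Net.Adj] using h⟩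

lemma exists_adj {N : Net α} {v : Fin N.n} (h : N.indeg v ≠ 0) : ∃ u, N.Adj u v := by
  unfold Net.indeg at h
  rw [← Nat.pos_iff_ne_zero, Finset.card_pos] at h
  obtain ⟨⟨a, b⟩, h⟩ := h
  simp at h
  exact ⟨a, h.2 ▸ h.1⟩

lemma adj_unique {N : Net α} {u u' v : Fin N.n} (hv : N.indeg v ≤ 1) (h : N.Adj u v)
    (h' : N.Adj u' v) : u = u' := by
  unfold Net.indeg at hv
  rw [Finset.card_le_one] at hv
  have := hv (u, v) (by simpa [Net.Adj] using h) (u', v) (by simpa [Net.Adj] using h')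
  simpa using this

lemma reaches_antisymm {N : Net α} (hac : ∀ v, ¬ Relation.TransGen N.Adj v v) {u v : Fin N.n}
    (h : N.Reaches u v) (h' : N.Reaches v u) : u = v := by
  rcases Relation.reflTransGen_iff_eq_or_transGen.1 h with e | h
  · exact e.symm
  · exact absurd (h.trans_left h') (hac u)

lemma wf_adj {N : Net α} (hac : ∀ v, ¬ Relation.TransGen N.Adj v v) :
    WellFounded (Relation.TransGen N.Adj) := by
  have : IsTrans _ (Relation.TransGen N.Adj) := ⟨fun _ _ _ => Relation.TransGen.trans⟩
  have : Std.Irrefl (Relation.TransGen N.Adj) := ⟨hac⟩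
  exact Finite.wellFounded_of_trans_of_irrefl _

/-- Tree edges: edges whose head has indegree one. -/
def TAdj (N : Net α) (u v : Fin N.n) : Prop := N.Adj u v ∧ N.indeg v = 1

def TR (N : Net α) : Fin N.n → Fin N.n → Prop := Relation.ReflTransGen (TAdj N)

lemma TR.reaches {N : Net α} {u v : Fin N.n} (h : TR N u v) : N.Reaches u v := by
  induction h with
  | refl => exact .refl
  | tail _ h ih => exact ih.tail h.1

lemma GoodPar.eq_of_tadj {N : Net α} {p : Fin N.n → Fin N.n} (hp : GoodPar N p) {u v : Fin N.n}
    (h : TAdj N u v) : p v = u :=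
  adj_unique h.2.le (hp.2 v (by rw [h.2]; simp)) h.1

lemma TR.anc {N : Net α} {p : Fin N.n → Fin N.n} (hp : GoodPar N p) {u v : Fin N.n}
    (h : TR N u v) : Anc p u v := by
  induction h with
  | refl => exact Anc.refl _ _
  | tail _ h ih =>
    have := hp.eq_of_tadj h
    subst this
    exact ih.trans (Anc.step _ _)

lemma lemA {N : Net α} {p : Fin N.n → Fin N.n} (hp : GoodPar N p) {u v w : Fin N.n}
    (h : TR N v w) (hu : Anc p u w) : Anc p u v ∨ (TR N v u ∧ TR N u w) := by
  induction h with
  | refl => left; exact hu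
  | tail h1 h2 ih =>
    have e := hp.eq_of_tadj h2
    rcases hu.eq_or with rfl | hu
    · right; exact ⟨h1.tail h2, .refl⟩
    · rw [e] at hu
      rcases ih hu with h | ⟨h, h'⟩
      · left; exact h
      · right; exact ⟨h, h'.tail h2⟩

lemma TR.chain {N : Net α} {u v w : Fin N.n} (h : TR N u w) (h' : TR N v w) :
    TR N u v ∨ TR N v u := by
  induction h with
  | refl => right; exact h'
  | tail h1 h2 ih =>
    rcases Relation.ReflTransGen.cases_tail h' with e | ⟨c, hc, hc'⟩
    · left; rw [← e]; exact h1.tail h2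
    · have := adj_unique h2.2.le h2.1 hc'.1
      subst this
      exact ih hc

lemma TR.eq_of_ne {N : Net α} {u v : Fin N.n} (h : TR N u v) (hv : N.indeg v ≠ 1) : u = v := by
  rcases Relation.ReflTransGen.cases_tail h with e | ⟨c, hc, hc'⟩
  · exact e.symm
  · exact absurd hc'.2 hv

lemma TR.top_unique {N : Net α} {u v w : Fin N.n} (h : TR N u w) (h' : TR N v w)
    (hu : N.indeg u ≠ 1) (hv : N.indeg v ≠ 1) : u = v := by
  rcases h.chain h' with h | h
  · exact h.eq_of_ne hv
  · exact (h.eq_of_ne hu).symm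

lemma exists_top {N : Net α} (hac : ∀ v, ¬ Relation.TransGen N.Adj v v) (w : Fin N.n) :
    ∃ h, N.indeg h ≠ 1 ∧ TR N h w := by
  induction w using (wf_adj hac).induction with
  | _ w ih =>
    by_cases hw : N.indeg w = 1
    · obtain ⟨u, hu⟩ := exists_adj (N := N) (v := w) (by rw [hw]; simp)
      obtain ⟨h, h1, h2⟩ := ih u (.single hu)
      exact ⟨h, h1, h2.tail ⟨hu, hw⟩⟩
    · exact ⟨w, hw, .refl⟩

lemma reaches_of_root {N : Net α} (hac : ∀ v, ¬ Relation.TransGen N.Adj v v) {ρ : Fin N.n}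
    (hρ : ∀ v, N.indeg v = 0 → v = ρ) (w : Fin N.n) : N.Reaches ρ w := by
  induction w using (wf_adj hac).induction with
  | _ w ih =>
    by_cases hw : N.indeg w = 0
    · rw [hρ w hw]; exact .refl
    · obtain ⟨u, hu⟩ := exists_adj hw
      exact (ih u (.single hu)).tail hu

/-- The taxa whose tree component is rooted in `D`. -/
noncomputable def zset (N : Net α) (D : Finset (Fin N.n)) : Finset α :=
  (Finset.univ.filter fun w => N.IsLeaf w ∧ ∃ v ∈ D, N.indeg v ≠ 1 ∧ TR N v w).image N.label

noncomputable def tset (N : Net α) (u : Fin N.n) : Finset α :=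
  (Finset.univ.filter fun w => N.IsLeaf w ∧ TR N u w).image N.label

section
variable {X : Finset α} {N : Net α}

lemma tset_compat (hinj : Set.InjOn N.label {v | N.IsLeaf v}) (u u' : Fin N.n) :
    Compatible (tset N u) (tset N u') := by
  by_cases h : tset N u ∩ tset N u' = ∅
  · left; exact h
  · right
    obtain ⟨x, hx⟩ := Finset.nonempty_iff_ne_empty.2 h
    simp only [tset, Finset.mem_inter, Finset.mem_image, Finset.mem_filter, Finset.mem_univ,
      true_and] at hx
    obtain ⟨⟨w, ⟨hw, hw2⟩, rfl⟩, w', ⟨hw', hw2'⟩, e⟩ := hx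
    obtain rfl := hinj hw' hw e
    have key : ∀ u u' : Fin N.n, TR N u u' → tset N u' ⊆ tset N u := by
      intro u u' h x hx
      simp only [tset, Finset.mem_image, Finset.mem_filter, Finset.mem_univ, true_and] at hx ⊢
      obtain ⟨w, ⟨h1, h2⟩, e⟩ := hx
      exact ⟨w, ⟨h1, Relation.ReflTransGen.trans h h2⟩, e⟩
    rcases hw2.chain hw2' with h | h
    · right; exact key _ _ h
    · left; exact key _ _ h

lemma tset_singleton {v : Fin N.n} (hv : N.indeg v ≠ 1) : zset N {v} = tset N v := by
  simp [zset, tset, hv]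

lemma zset_insert (v : Fin N.n) (D : Finset (Fin N.n)) :
    zset N (insert v D) = zset N D ∪ zset N {v} := by
  ext x
  simp only [zset, Finset.mem_image, Finset.mem_filter, Finset.mem_univ, true_and,
    Finset.mem_union, Finset.mem_insert, Finset.mem_singleton, exists_eq_or_imp]
  constructor
  · rintro ⟨w, ⟨h, h1 | h1⟩, e⟩
    · right; exact ⟨w, ⟨h, v, rfl, h1⟩, e⟩
    · left; exact ⟨w, ⟨h, h1⟩, e⟩
  · rintro (⟨w, ⟨h, h1⟩, e⟩ | ⟨w, ⟨h, h1⟩, e⟩)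
    · exact ⟨w, ⟨h, .inr h1⟩, e⟩
    · obtain ⟨v', rfl, h1⟩ := h1
      exact ⟨w, ⟨h, .inl h1⟩, e⟩

lemma mem_tset (hinj : Set.InjOn N.label {v | N.IsLeaf v}) {u w : Fin N.n} (hw : N.IsLeaf w) :
    N.label w ∈ tset N u ↔ TR N u w := by
  simp only [tset, Finset.mem_image, Finset.mem_filter, Finset.mem_univ, true_and]
  constructor
  · rintro ⟨w', ⟨h1, h2⟩, e⟩
    rwa [← hinj h1 hw e]
  · intro h; exact ⟨w, ⟨hw, h⟩, rfl⟩

lemma mem_zset (hinj : Set.InjOn N.label {v | N.IsLeaf v}) {D : Finset (Fin N.n)} {w : Fin N.n}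
    (hw : N.IsLeaf w) :
    N.label w ∈ zset N D ↔ ∃ v ∈ D, N.indeg v ≠ 1 ∧ TR N v w := by
  simp only [zset, Finset.mem_image, Finset.mem_filter, Finset.mem_univ, true_and]
  constructor
  · rintro ⟨w', ⟨h1, h2⟩, e⟩
    rwa [← hinj h1 hw e]
  · intro h; exact ⟨w, ⟨hw, h⟩, rfl⟩

lemma key_lemma (hN : IsPhyloNet X N) {C : Finset α} (hCX : C ⊆ X) (hC : Rep N C)
    {D : Finset (Fin N.n)} {v : Fin N.n} (hv : N.indeg v ≠ 1)
    (hmin : ∀ h, 2 ≤ N.indeg h → N.Reaches v h → h = v ∨ h ∈ D) :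
    (C ∩ tset N v = ∅ ∨ ∃ u, C ∩ tset N v = tset N u) ∧
    (C ∩ tset N v = ∅ ∨ tset N v ⊆ C ∨ C \ zset N D ⊆ tset N v) := by
  obtain ⟨hac, -, -, -, hbij⟩ := hN
  have hinj := hbij.injOn
  have hsurj : ∀ x ∈ X, ∃ w, N.IsLeaf w ∧ N.label w = x := fun x hx => by
    obtain ⟨w, hw, e⟩ := hbij.surjOn hx
    exact ⟨w, hw, e⟩
  obtain ⟨p, u, hp, hpu⟩ := hC
  by_cases hu : TR N v u
  · constructor
    · right
      refine ⟨u, ?_⟩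
      ext x
      constructor
      · intro hx
        obtain ⟨hx1, hx2⟩ := Finset.mem_inter.1 hx
        obtain ⟨w, hw, rfl⟩ := hsurj x (hCX hx1)
        rw [hpu w hw] at hx1
        rw [mem_tset hinj hw] at hx2 ⊢
        rcases lemA hp hx2 hx1 with h | h
        · have := reaches_antisymm hac (hp.1.reaches h) hu.reaches
          rwa [this]
        · exact h.2
      · intro hx
        have : ∃ w, N.IsLeaf w ∧ N.label w = x := by
          simp only [tset, Finset.mem_image, Finset.mem_filter, Finset.mem_univ, true_and] at hx
          obtain ⟨w, h, e⟩ := hx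
          exact ⟨w, h.1, e⟩
        obtain ⟨w, hw, rfl⟩ := this
        rw [Finset.mem_inter, hpu w hw, mem_tset hinj hw]
        rw [mem_tset hinj hw] at hx
        exact ⟨hx.anc hp, Relation.ReflTransGen.trans hu hx⟩
    · right; right
      intro x hx
      obtain ⟨hx1, hx2⟩ := Finset.mem_sdiff.1 hx
      obtain ⟨w, hw, rfl⟩ := hsurj x (hCX hx1)
      rw [hpu w hw] at hx1
      rw [mem_zset hinj hw] at hx2
      rw [mem_tset hinj hw]
      obtain ⟨h, hh, hw2⟩ := exists_top hac w
      have : h = v := by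
        rcases lemA hp hw2 hx1 with h3 | h3
        · have hr : N.Reaches v h := hu.reaches.trans (hp.1.reaches h3)
          by_contra hne
          have : N.indeg h ≠ 0 := by
            rcases Relation.ReflTransGen.cases_tail hr with e | ⟨c, -, hc⟩
            · exact absurd e hne
            · exact adj_indeg hc
          rcases hmin h (by omega) hr with e | e
          · exact hne e
          · exact hx2 ⟨h, e, hh, hw2⟩
        · exact TR.top_unique h3.1 hu hh hv
      rwa [this] at hw2
  · have key : ∀ w, N.IsLeaf w → TR N v w → (N.label w ∈ C ↔ Anc p u v) := by
      intro w hw h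
      rw [hpu w hw]
      constructor
      · intro h'
        rcases lemA hp h h' with h3 | h3
        · exact h3
        · exact absurd h3.1 hu
      · intro h'
        exact h'.trans (h.anc hp)
    by_cases ha : Anc p u v
    · have hsub : tset N v ⊆ C := by
        intro x hx
        simp only [tset, Finset.mem_image, Finset.mem_filter, Finset.mem_univ, true_and] at hx
        obtain ⟨w, ⟨h1, h2⟩, rfl⟩ := hx
        exact (key w h1 h2).2 ha
      exact ⟨.inr ⟨v, Finset.inter_eq_right.2 hsub⟩, .inr (.inl hsub)⟩
    · have hemp : C ∩ tset N v = ∅ := by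
        rw [Finset.eq_empty_iff_forall_notMem]
        intro x hx
        obtain ⟨hx0, hx⟩ := Finset.mem_inter.1 hx
        simp only [tset, Finset.mem_image, Finset.mem_filter, Finset.mem_univ, true_and] at hx
        obtain ⟨w, ⟨h1, h2⟩, rfl⟩ := hx
        exact ha ((key w h1 h2).1 hx0)
      exact ⟨.inl hemp, .inl hemp⟩

lemma inter_pc (hinj : Set.InjOn N.label {v | N.IsLeaf v}) {A B : Finset α} {v : Fin N.n}
    (hA : A ∩ tset N v = ∅ ∨ ∃ u, A ∩ tset N v = tset N u)
    (hB : B ∩ tset N v = ∅ ∨ ∃ u, B ∩ tset N v = tset N u) :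
    Compatible (A ∩ tset N v) (B ∩ tset N v) := by
  rcases hA with hA | ⟨u, hA⟩
  · left; rw [hA]; simp
  rcases hB with hB | ⟨u', hB⟩
  · left; rw [hB]; simp
  rw [hA, hB]
  exact tset_compat hinj _ _

lemma exists_seq (hN : IsPhyloNet X N) {𝒞 : Set (Finset α)} (hX : ∀ C ∈ 𝒞, C ⊆ X)
    (h𝒞 : ∀ C ∈ 𝒞, Rep N C) (k : ℕ) : ∀ D : Finset (Fin N.n),
    (∀ v ∈ D, 2 ≤ N.indeg v) →
    ((Finset.univ.filter fun v => 2 ≤ N.indeg v) \ D).card = k →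
    (∀ v ∈ D, ∀ h, 2 ≤ N.indeg h → N.Reaches v h → h ∈ D) →
    ∃ L : List (Finset α), IsSTTreeSeq (X \ zset N D) (removeTaxa 𝒞 (zset N D)) L ∧
      L.length = k := by
  have hac := hN.1
  have hinj := hN.2.2.2.2.injOn
  induction k with
  | zero =>
    intro D hD hk hdc
    refine ⟨[], ⟨trivial, ?_⟩, rfl⟩
    obtain ⟨ρ, hρ, hρu⟩ := hN.2.1
    have hall : ∀ v, 2 ≤ N.indeg v → v ∈ D := by
      intro v hv
      rw [Finset.card_eq_zero, Finset.sdiff_eq_empty_iff_subset] at hk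
      exact hk (by simpa using hv)
    have hρ1 : N.indeg ρ ≠ 1 := by
      have : N.indeg ρ = 0 := hρ
      omega
    have key : ∀ C ∈ 𝒞, C \ zset N D = C ∩ tset N ρ := by
      intro C hC
      ext x
      rw [Finset.mem_sdiff, Finset.mem_inter]
      refine and_congr_right fun hx => ?_
      obtain ⟨w, hw, rfl⟩ := hN.2.2.2.2.surjOn (hX C hC hx)
      rw [mem_zset hinj hw, mem_tset hinj hw]
      constructor
      · intro h
        obtain ⟨a, ha, ha'⟩ := exists_top hac w
        by_cases h0 : N.indeg a = 0
        · rwa [← hρu a h0]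
        · exact absurd ⟨a, hall a (by omega), ha, ha'⟩ h
      · rintro h ⟨v, hv, hv1, hv2⟩
        have := hv2.top_unique h hv1 hρ1
        have h2 := hD v hv
        rw [this] at h2
        have : N.indeg ρ = 0 := hρ
        omega
    rintro A ⟨-, A, hA, rfl⟩ B ⟨-, B, hB, rfl⟩
    rw [key A hA, key B hB]
    exact inter_pc hinj
      (key_lemma hN (hX A hA) (h𝒞 A hA) hρ1 (D := D) fun h h1 _ => .inr (hall h h1)).1
      (key_lemma hN (hX B hB) (h𝒞 B hB) hρ1 (D := D) fun h h1 _ => .inr (hall h h1)).1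
  | succ k ih =>
    intro D hD hk hdc
    have hne : ((Finset.univ.filter fun v => 2 ≤ N.indeg v) \ D).Nonempty := by
      rw [← Finset.card_pos]; omega
    obtain ⟨v, hv, hvm⟩ : ∃ v, v ∈ ((Finset.univ.filter fun v => 2 ≤ N.indeg v) \ D) ∧
        ∀ h ∈ ((Finset.univ.filter fun v => 2 ≤ N.indeg v) \ D), N.Reaches v h → h = v := by
      have : IsTrans _ (flip (Relation.TransGen N.Adj)) :=
        ⟨fun _ _ _ h h' => Relation.TransGen.trans h' h⟩
      have : Std.Irrefl (flip (Relation.TransGen N.Adj)) := ⟨hac⟩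
      have wf := Finite.wellFounded_of_trans_of_irrefl (flip (Relation.TransGen N.Adj))
      obtain ⟨v, hv, hm⟩ := wf.has_min
        (((Finset.univ.filter fun v => 2 ≤ N.indeg v) \ D : Finset (Fin N.n)) : Set (Fin N.n)) hne
      refine ⟨v, hv, fun h hh hr => ?_⟩
      rcases Relation.reflTransGen_iff_eq_or_transGen.1 hr with e | hr
      · exact e
      · exact absurd hr (hm h hh)
    have hv' := hv
    simp only [Finset.mem_sdiff, Finset.mem_filter, Finset.mem_univ, true_and] at hv
    obtain ⟨hv2, hvD⟩ := hv
    have hv1 : N.indeg v ≠ 1 := by omega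
    have hmin : ∀ h, 2 ≤ N.indeg h → N.Reaches v h → h = v ∨ h ∈ D := by
      intro h h1 h2
      by_cases hd : h ∈ D
      · exact .inr hd
      · exact .inl (hvm h (by simp [hd, h1]) h2)
    obtain ⟨L, ⟨hL1, hL2⟩, hlen⟩ := ih (insert v D)
      (by
        intro a ha
        rcases Finset.mem_insert.1 ha with rfl | ha
        · exact hv2
        · exact hD a ha)
      (by
        rw [Finset.sdiff_insert, Finset.card_erase_of_mem hv', hk]
        rfl)
      (by
        intro a ha h h1 h2
        rcases Finset.mem_insert.1 ha with rfl | ha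
        · exact Finset.mem_insert.2 (hmin h h1 h2)
        · exact Finset.mem_insert_of_mem (hdc a ha h h1 h2))
    have e1 : X \ zset N (insert v D) = (X \ zset N D) \ tset N v := by
      rw [zset_insert, tset_singleton hv1, sdiff_sdiff_left]; rfl
    have e2 : removeTaxa 𝒞 (zset N (insert v D)) =
        removeTaxa (removeTaxa 𝒞 (zset N D)) (tset N v) := by
      rw [zset_insert, tset_singleton hv1, removeTaxa_removeTaxa]
    rw [e1, e2] at hL1
    rw [e2] at hL2
    have hdisj : Disjoint (tset N v) (zset N D) := by
      rw [Finset.disjoint_left]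
      intro x hx hx'
      have : ∃ w, N.IsLeaf w ∧ N.label w = x := by
        simp only [tset, Finset.mem_image, Finset.mem_filter, Finset.mem_univ, true_and] at hx
        obtain ⟨w, h, e⟩ := hx
        exact ⟨w, h.1, e⟩
      obtain ⟨w, hw, rfl⟩ := this
      rw [mem_tset hinj hw] at hx
      rw [mem_zset hinj hw] at hx'
      obtain ⟨a, ha, ha1, ha2⟩ := hx'
      have := hx.top_unique ha2 hv1 ha1
      exact hvD (this ▸ ha)
    have hint : ∀ C : Finset α, (C \ zset N D) ∩ tset N v = C ∩ tset N v := by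
      intro C
      ext x
      have := fun h : x ∈ tset N v => Finset.disjoint_left.1 hdisj h
      simp only [Finset.mem_inter, Finset.mem_sdiff]
      tauto
    refine ⟨tset N v :: L, ⟨⟨⟨?_, ?_, ?_⟩, hL1⟩, hL2⟩, by simp [hlen]⟩
    · intro x hx
      rw [Finset.mem_sdiff]
      refine ⟨?_, Finset.disjoint_left.1 hdisj hx⟩
      simp only [tset, Finset.mem_image, Finset.mem_filter, Finset.mem_univ, true_and] at hx
      obtain ⟨w, ⟨h1, -⟩, rfl⟩ := hx
      exact hN.2.2.2.2.mapsTo h1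
    · rintro C ⟨-, C, hC, rfl⟩
      rcases (key_lemma hN (hX C hC) (h𝒞 C hC) hv1 hmin).2 with h | h | h
      · left; rw [hint, h]
      · right; right
        intro x hx
        exact Finset.mem_sdiff.2 ⟨h hx, Finset.disjoint_left.1 hdisj hx⟩
      · right; left; exact h
    · rintro A ⟨-, A, ⟨-, A, hA, rfl⟩, rfl⟩ B ⟨-, B, ⟨-, B, hB, rfl⟩, rfl⟩
      rw [hint, hint]
      exact inter_pc hinj (key_lemma hN (hX A hA) (h𝒞 A hA) hv1 hmin).1
        (key_lemma hN (hX B hB) (h𝒞 B hB) hv1 hmin).1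

end

/-! Displayed trees give parent functions. -/

lemma mem_internals {β : Type} {l : List β} {i : ℕ} {t : β} (h : l[i + 1]? = some t)
    (hi : i + 2 < l.length) : t ∈ internals l := by
  unfold internals
  rw [List.mem_iff_getElem?]
  refine ⟨i, ?_⟩
  rw [List.getElem?_dropLast, if_pos (by rw [List.length_tail]; omega), List.getElem?_tail, h]

lemma path_nodup {N : Net α} (hac : ∀ v, ¬ Relation.TransGen N.Adj v v) {l : List (Fin N.n)}
    (h : l.IsChain N.Adj) : l.Nodup := by
  have h1 : l.IsChain (Relation.TransGen N.Adj) := h.imp fun _ _ h => .single h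
  have : IsTrans _ (Relation.TransGen N.Adj) := ⟨fun _ _ _ => Relation.TransGen.trans⟩
  have h2 := List.isChain_iff_pairwise.1 h1
  refine List.Pairwise.imp ?_ h2
  rintro a b h rfl
  exact hac _ h

lemma rep_of_represents {X : Finset α} {N : Net α} (hN : IsPhyloNet X N) {C : Finset α}
    (hC : RepresentsCluster X N C) : Rep N C := by
  obtain ⟨T, ⟨hT, hT0⟩, ⟨φ, hφ, hleaf, P, hP1, hP2, hP3⟩, ⟨a, b⟩, hab, rfl⟩ := hC
  have hac := hN.1
  have hT1 : ∀ v, T.indeg v ≤ 1 := by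
    intro v
    unfold Net.reticNum at hT0
    rw [Finset.sum_eq_zero_iff] at hT0
    have := hT0 v (Finset.mem_univ _)
    omega
  -- tree edges of the subdivision
  let F : Fin N.n → Fin N.n → Prop := fun s t =>
    ∃ e ∈ T.E, ∃ i, (P e)[i]? = some s ∧ (P e)[i + 1]? = some t
  have hhead : ∀ e ∈ T.E, (P e)[0]? = some (φ e.1) := by
    intro e he
    rw [← List.head?_eq_getElem?]; exact (hP1 e he).1
  have hlast : ∀ e ∈ T.E, (P e)[(P e).length - 1]? = some (φ e.2) := by
    intro e he
    rw [← List.getLast?_eq_getElem?]; exact (hP1 e he).2.1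
  have hchain : ∀ e ∈ T.E, (P e).IsChain N.Adj := fun e he => (hP1 e he).2.2.1
  have hnodup : ∀ e ∈ T.E, (P e).Nodup := fun e he => path_nodup hac (hchain e he)
  have hFadj : ∀ s t, F s t → N.Adj s t := by
    rintro s t ⟨e, he, i, h1, h2⟩
    have := List.isChain_iff_getElem.1 (hchain e he) i
    obtain ⟨h3, h4⟩ := List.getElem?_eq_some_iff.1 h2
    obtain ⟨h5, h6⟩ := List.getElem?_eq_some_iff.1 h1
    have := this h3
    rwa [h4, h6] at this
  have hpos : ∀ e ∈ T.E, ∀ i t, (P e)[i + 1]? = some t → t ∈ internals (P e) ∨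
      (t = φ e.2 ∧ i + 2 = (P e).length) := by
    intro e he i t h
    obtain ⟨h3, h4⟩ := List.getElem?_eq_some_iff.1 h
    by_cases hi : i + 2 < (P e).length
    · left; exact mem_internals h hi
    · right
      have hi : i + 1 = (P e).length - 1 := by omega
      have := hlast e he
      rw [← hi, h] at this
      exact ⟨by simpa using this, by omega⟩
  have hFuniq : ∀ s s' t, F s t → F s' t → s = s' := by
    rintro s s' t ⟨e, he, i, h1, h2⟩ ⟨f, hf, j, h1', h2'⟩
    have hef : e = f := by
      by_contra hne
      rcases hpos e he i t h2 with h | ⟨h, -⟩ <;> rcases hpos f hf j t h2' with h' | ⟨h', -⟩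
      · exact hP3 e he f hf hne t h h'
      · exact hP2 e he t h ⟨_, h'.symm⟩
      · exact hP2 f hf t h' ⟨_, h.symm⟩
      · have e2 : e.2 = f.2 := hφ (h.symm.trans h')
        have e1 : e.1 = f.1 := adj_unique (N := T) (v := e.2) (hT1 _) he (by
          rw [e2]; exact hf)
        exact hne (Prod.ext e1 e2)
    subst hef
    obtain ⟨h3, h4⟩ := List.getElem?_eq_some_iff.1 h2
    obtain ⟨h3', h4'⟩ := List.getElem?_eq_some_iff.1 h2'
    have := (hnodup e he).getElem_inj_iff.1 (h4.trans h4'.symm)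
    have hij : i = j := by omega
    subst hij
    rw [h1] at h1'
    simpa using h1'
  let p : Fin N.n → Fin N.n := fun t =>
    if h : ∃ s, F s t then h.choose else if h : ∃ s, N.Adj s t then h.choose else t
  have hpF : ∀ s t, F s t → p t = s := by
    intro s t h
    have hex : ∃ s, F s t := ⟨s, h⟩
    simp only [p, dif_pos hex]
    exact hFuniq _ _ _ hex.choose_spec h
  have hp : GoodPar N p := by
    constructor
    · intro v
      simp only [p]
      split_ifs with h h'
      · left; exact hFadj _ _ h.choose_spec
      · left; exact h'.choose_spec
      · right; rfl
    · intro v hv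
      simp only [p]
      split_ifs with h h'
      · exact hFadj _ _ h.choose_spec
      · exact h'.choose_spec
      · exact absurd (exists_adj hv) h'
  have hedge : ∀ e ∈ T.E, Anc p (φ e.1) (φ e.2) := by
    intro e he
    have : ∀ (i : ℕ) s, (P e)[i]? = some s → Anc p (φ e.1) s := by
      intro i
      induction i with
      | zero =>
        intro s hs
        rw [hhead e he] at hs
        obtain rfl : φ e.1 = s := by simpa using hs
        exact Anc.refl _ _
      | succ i ih =>
        intro s hs
        obtain ⟨h3, h4⟩ := List.getElem?_eq_some_iff.1 hs
        have hi : (P e)[i]? = some (P e)[i] := List.getElem?_eq_getElem (by omega)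
        have h5 := hpF _ _ ⟨e, he, i, hi, hs⟩
        have := ih _ hi
        rw [← h5] at this
        exact this.trans (Anc.step _ _)
    exact this _ _ (hlast e he)
  have hreach : ∀ u w, T.Reaches u w → Anc p (φ u) (φ w) := by
    intro u w h
    induction h with
    | refl => exact Anc.refl _ _
    | tail _ h ih => exact ih.trans (hedge _ h)
  obtain ⟨ρ, hρ, hρu⟩ := hT.2.1
  have hroot := reaches_of_root hT.1 (ρ := ρ) hρu
  have hback : ∀ w, Anc p (φ b) (φ w) → T.Reaches b w := by
    intro w
    have hw := hroot w
    induction hw with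
    | refl =>
      intro h
      have h1 := hp.1.reaches h
      have h2 := hp.1.reaches (hreach _ _ (hroot b))
      have := hφ (reaches_antisymm hac h1 h2)
      rw [this]; exact .refl
    | @tail w' w hw' hadj ih =>
      intro h
      have hclaim : ∀ (i : ℕ) s, (P (w', w))[i]? = some s → Anc p (φ b) s →
          Anc p (φ b) (φ w') ∨ ∃ j, (P (w', w))[j + 1]? = some (φ b) := by
        intro i
        induction i with
        | zero =>
          intro s hs ha
          rw [hhead _ hadj] at hs
          obtain rfl : φ w' = s := by simpa using hs
          exact .inl ha
        | succ i ih2 =>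
          intro s hs ha
          rcases ha.eq_or with rfl | ha
          · right; exact ⟨i, hs⟩
          · obtain ⟨h3, h4⟩ := List.getElem?_eq_some_iff.1 hs
            have hi : (P (w', w))[i]? = some (P (w', w))[i] :=
              List.getElem?_eq_getElem (by omega)
            have h5 := hpF _ _ ⟨_, hadj, i, hi, hs⟩
            rw [h5] at ha
            exact ih2 _ hi ha
      rcases hclaim _ _ (hlast _ hadj) h with h | ⟨j, hj⟩
      · exact (ih h).tail hadj
      · rcases hpos _ hadj j _ hj with h | ⟨h, -⟩
        · exact absurd ⟨b, rfl⟩ (hP2 _ hadj _ h)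
        · have : b = w := hφ h
          rw [this]; exact .refl
  refine ⟨p, φ b, hp, fun w hw => ?_⟩
  simp only [Net.clusterBelow, Finset.mem_image, Finset.mem_filter, Finset.mem_univ, true_and]
  constructor
  · rintro ⟨t, ⟨ht, htl⟩, e⟩
    obtain ⟨h1, h2⟩ := hleaf t htl
    have : φ t = w := hN.2.2.2.2.injOn h1 hw (h2.trans e)
    rw [← this]
    exact hreach _ _ ht
  · intro h
    obtain ⟨t, htl, e⟩ := hT.2.2.2.2.surjOn (hN.2.2.2.2.mapsTo hw)
    obtain ⟨h1, h2⟩ := hleaf t htl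
    have : φ t = w := hN.2.2.2.2.injOn h1 hw (h2.trans e)
    rw [← this] at h
    exact ⟨t, ⟨hback t h, htl⟩, e⟩

lemma exists_seq_of_net {X : Finset α} {𝒞 : Set (Finset α)} (h𝒞 : IsClusterSet X 𝒞) {N : Net α}
    (hN : IsPhyloNet X N) (hR : RepresentsSet X N 𝒞) :
    ∃ L : List (Finset α), IsMaxSTTreeSeq X 𝒞 L ∧ L.length ≤ N.reticNum := by
  obtain ⟨L, hL, hlen⟩ := exists_seq hN (𝒞 := 𝒞) (fun C hC => (h𝒞 C hC).1)
    (fun C hC => rep_of_represents hN (hR C hC)) _ ∅ (by simp) rfl (by simp)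
  have e0 : zset N ∅ = ∅ := by simp [zset]
  have e1 : removeTaxa 𝒞 ∅ = 𝒞 := by
    ext D
    simp only [removeTaxa, Finset.sdiff_empty, Set.mem_ofPred_eq]
    constructor
    · rintro ⟨-, C, hC, rfl⟩; exact hC
    · intro h; exact ⟨(h𝒞 D h).2.1, D, h, rfl⟩
  rw [e0, e1, Finset.sdiff_empty] at hL
  obtain ⟨M, hM, hMl⟩ := exists_max_seq _ L X 𝒞 rfl hL
  refine ⟨M, hM, hMl.trans ?_⟩
  rw [hlen, Finset.sdiff_empty, Finset.card_filter]
  unfold Net.reticNum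
  apply Finset.sum_le_sum
  intro v _
  split_ifs <;> omega

/-! Every cluster set is represented by some network. -/

lemma indeg_le_one {N : Net α} {v : Fin N.n} (h : ∀ u u', N.Adj u v → N.Adj u' v → u = u') :
    N.indeg v ≤ 1 := by
  unfold Net.indeg
  rw [Finset.card_le_one]
  rintro ⟨a, a'⟩ ha ⟨b, b'⟩ hb
  simp only [Finset.mem_filter] at ha hb
  obtain ⟨ha, rfl⟩ := ha
  obtain ⟨hb, rfl⟩ := hb
  rw [h a b ha hb]

lemma indeg_zero {N : Net α} {v : Fin N.n} (h : ∀ u, ¬ N.Adj u v) : N.indeg v = 0 := by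
  by_contra h0
  obtain ⟨u, hu⟩ := exists_adj h0
  exact h u hu

lemma two_le_indeg {N : Net α} {u u' v : Fin N.n} (hu : N.Adj u v) (hu' : N.Adj u' v)
    (h : u ≠ u') : 2 ≤ N.indeg v := by
  by_contra hlt
  exact h (adj_unique (by omega) hu hu')

lemma one_le_outdeg {N : Net α} {u v : Fin N.n} (hu : N.Adj u v) : 1 ≤ N.outdeg u := by
  unfold Net.outdeg
  rw [Nat.succ_le_iff, Finset.card_pos]
  exact ⟨(u, v), by simpa [Net.Adj] using hu⟩

lemma two_le_outdeg {N : Net α} {u v v' : Fin N.n} (hu : N.Adj u v) (hu' : N.Adj u v')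
    (h : v ≠ v') : 2 ≤ N.outdeg u := by
  unfold Net.outdeg
  rw [Nat.succ_le_iff, Finset.one_lt_card]
  exact ⟨(u, v), by simpa [Net.Adj] using hu, (u, v'), by simpa [Net.Adj] using hu',
    by simpa using h⟩

lemma outdeg_zero {N : Net α} {u : Fin N.n} (h : ∀ v, ¬ N.Adj u v) : N.outdeg u = 0 := by
  unfold Net.outdeg
  rw [Finset.card_eq_zero, Finset.filter_eq_empty_iff]
  rintro ⟨a, b⟩ hab rfl
  exact h b hab

/-- The network with node type `V` and edge relation `R`. -/
noncomputable def mkNet (V : Type) [Finite V] (R : V → V → Prop) (lab : V → α) : Net α where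
  n := Nat.card V
  E := Finset.univ.filter fun e => R ((Finite.equivFin V).symm e.1) ((Finite.equivFin V).symm e.2)
  label := fun i => lab ((Finite.equivFin V).symm i)

section
variable {V : Type} [Finite V] {R : V → V → Prop} {lab : V → α}

/-- The node of `mkNet` corresponding to `v`. -/
noncomputable def nd (R : V → V → Prop) (lab : V → α) (v : V) : Fin (mkNet V R lab).n :=
  Finite.equivFin V v

lemma nd_surj (i : Fin (mkNet V R lab).n) : ∃ v, nd R lab v = i :=
  (Finite.equivFin V).surjective i

lemma nd_inj {u v : V} (h : nd R lab u = nd R lab v) : u = v :=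
  (Finite.equivFin V).injective h

lemma nd_adj {u v : V} : (mkNet V R lab).Adj (nd R lab u) (nd R lab v) ↔ R u v := by
  have : (mkNet V R lab).Adj (nd R lab u) (nd R lab v) ↔
      R ((Finite.equivFin V).symm (Finite.equivFin V u))
        ((Finite.equivFin V).symm (Finite.equivFin V v)) := by
    refine Finset.mem_filter.trans ?_
    exact ⟨fun h => h.2, fun h => ⟨Finset.mem_univ _, h⟩⟩
  simpa using this

lemma nd_label (v : V) : (mkNet V R lab).label (nd R lab v) = lab v := by
  simp [mkNet, nd]

lemma mk_acyclic (rk : V → ℕ) (hrk : ∀ u v, R u v → rk u < rk v) (v : Fin (mkNet V R lab).n) :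
    ¬ Relation.TransGen (mkNet V R lab).Adj v v := by
  have : ∀ a b : Fin (mkNet V R lab).n, Relation.TransGen (mkNet V R lab).Adj a b →
      rk ((Finite.equivFin V).symm a) < rk ((Finite.equivFin V).symm b) := by
    have h1 : ∀ a b : Fin (mkNet V R lab).n, (mkNet V R lab).Adj a b →
        rk ((Finite.equivFin V).symm a) < rk ((Finite.equivFin V).symm b) := by
      intro a b h
      apply hrk
      exact (Finset.mem_filter.1 h).2
    intro a b h
    induction h with
    | single h => exact h1 _ _ h
    | tail _ h ih => exact ih.trans (h1 _ _ h)
  intro h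
  exact lt_irrefl _ (this v v h)

end

/-- Nodes of the trees used. -/
inductive TV (X : Finset α) : Type
  | root : TV X
  | c : TV X
  | leaf (x : X) : TV X

/-- Nodes of the universal network. -/
inductive UV (X : Finset α) : Type
  | root : UV X
  | cl (D : Finset X) (h : 2 ≤ D.card) : UV X
  | ret (x : X) : UV X
  | leaf (x : X) : UV X

instance (X : Finset α) : Finite (TV X) := by
  let f : Option (Option X) → TV X := fun o =>
    match o with
    | none => .root
    | some none => .c
    | some (some x) => .leaf x
  refine Finite.of_surjective f ?_
  rintro (_ | _ | x)
  · exact ⟨none, rfl⟩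
  · exact ⟨some none, rfl⟩
  · exact ⟨some (some x), rfl⟩

instance (X : Finset α) : Finite (UV X) := by
  let f : Option ({D : Finset X // 2 ≤ D.card} ⊕ X ⊕ X) → UV X := fun o =>
    match o with
    | none => .root
    | some (.inl D) => .cl D.1 D.2
    | some (.inr (.inl x)) => .ret x
    | some (.inr (.inr x)) => .leaf x
  refine Finite.of_surjective f ?_
  rintro (_ | ⟨D, h⟩ | x | x)
  · exact ⟨none, rfl⟩
  · exact ⟨some (.inl ⟨D, h⟩), rfl⟩
  · exact ⟨some (.inr (.inl x)), rfl⟩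
  · exact ⟨some (.inr (.inr x)), rfl⟩

def TRel (X : Finset α) (D : Finset X) : TV X → TV X → Prop
  | .root, .c => True
  | .root, .leaf x => x ∉ D
  | .c, .leaf x => x ∈ D
  | _, _ => False

def URel (X : Finset α) : UV X → UV X → Prop
  | .root, .cl _ _ => True
  | .root, .ret _ => True
  | .cl D _, .ret x => x ∈ D
  | .ret x, .leaf y => x = y
  | _, _ => False

def tlab (X : Finset α) (x₀ : α) : TV X → α
  | .leaf x => x
  | _ => x₀

def ulab (X : Finset α) (x₀ : α) : UV X → α
  | .leaf x => x
  | _ => x₀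

noncomputable def tNet (X : Finset α) (x₀ : α) (D : Finset X) : Net α :=
  mkNet (TV X) (TRel X D) (tlab X x₀)

noncomputable def uNet (X : Finset α) (x₀ : α) : Net α := mkNet (UV X) (URel X) (ulab X x₀)

section
variable {X : Finset α} {x₀ : α} {D : Finset X}

lemma tNet_leaf (x : X) : (tNet X x₀ D).IsLeaf (nd _ _ (.leaf x)) := by
  apply outdeg_zero
  intro v
  obtain ⟨v, rfl⟩ := nd_surj v
  intro h
  have := nd_adj.1 h
  simp [TRel] at this

lemma tNet_leaf_iff (hD : 2 ≤ D.card) (v : TV X)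
    (h : (tNet X x₀ D).IsLeaf (nd _ _ v)) : ∃ x, v = .leaf x := by
  obtain ⟨d, hd⟩ : D.Nonempty := by rw [← Finset.card_pos]; omega
  unfold Net.IsLeaf at h
  match v, h with
  | .root, h =>
    have := one_le_outdeg (nd_adj.2 (show TRel X D .root .c from trivial) :
      (tNet X x₀ D).Adj _ _)
    exact absurd h (Nat.one_le_iff_ne_zero.1 this)
  | .c, h =>
    have := one_le_outdeg (nd_adj.2 (show TRel X D .c (.leaf d) from hd) :
      (tNet X x₀ D).Adj _ _)
    exact absurd h (Nat.one_le_iff_ne_zero.1 this)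
  | .leaf x, h => exact ⟨x, rfl⟩

lemma tNet_indeg (v) : (tNet X x₀ D).indeg v ≤ 1 := by
  apply indeg_le_one
  intro u u' h h'
  obtain ⟨v, rfl⟩ := nd_surj v
  obtain ⟨u, rfl⟩ := nd_surj u
  obtain ⟨u', rfl⟩ := nd_surj u'
  have h := nd_adj.1 h
  have h' := nd_adj.1 h'
  have : u = u' := by
    clear * - h h'
    cases u <;> cases u' <;> cases v <;> simp_all [TRel]
  rw [this]

lemma tNet_tree (hD : 2 ≤ D.card) : IsPhyloTree X (tNet X x₀ D) := by
  refine ⟨⟨?_, ?_, ?_, ?_, ?_⟩, ?_⟩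
  · refine mk_acyclic (fun v => match v with | .root => 0 | .c => 1 | .leaf _ => 2) ?_
    intro u v h
    cases u <;> cases v <;> simp_all [TRel]
  · refine ⟨nd _ _ .root, ?_, ?_⟩
    · apply indeg_zero
      intro u h
      obtain ⟨u, rfl⟩ := nd_surj u
      have h := nd_adj.1 h
      cases u <;> simp [TRel] at h
    · intro v hv
      obtain ⟨v, rfl⟩ := nd_surj v
      match v, hv with
      | .root, _ => rfl
      | .c, hv =>
        exact absurd hv (adj_indeg (N := tNet X x₀ D)
          (nd_adj.2 (show TRel X D .root .c from trivial)))
      | .leaf x, hv =>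
        by_cases hx : x ∈ D
        · exact absurd hv (adj_indeg (N := tNet X x₀ D)
            (nd_adj.2 (show TRel X D .c (.leaf x) from hx)))
        · exact absurd hv (adj_indeg (N := tNet X x₀ D)
            (nd_adj.2 (show TRel X D .root (.leaf x) from hx)))
  · rintro v ⟨h1, h2⟩
    obtain ⟨v, rfl⟩ := nd_surj v
    match v, h1, h2 with
    | .root, h1, h2 =>
      obtain ⟨u, hu⟩ := exists_adj (N := tNet X x₀ D) (v := nd _ _ .root) (by rw [h1]; simp)
      obtain ⟨u, rfl⟩ := nd_surj u
      have h := nd_adj.1 hu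
      cases u <;> simp [TRel] at h
    | .c, h1, h2 =>
      obtain ⟨x, hx, y, hy, hxy⟩ := Finset.one_lt_card.1 hD
      have := two_le_outdeg (N := tNet X x₀ D)
        (nd_adj.2 (show TRel X D .c (.leaf x) from hx))
        (nd_adj.2 (show TRel X D .c (.leaf y) from hy))
        (fun e => hxy (by simpa using nd_inj e))
      omega
    | .leaf x, h1, h2 =>
      have : (tNet X x₀ D).outdeg _ = 0 := tNet_leaf x
      omega
  · intro v hv
    have := tNet_indeg v
    omega
  · refine ⟨?_, ?_, ?_⟩
    · intro v hv
      obtain ⟨v, rfl⟩ := nd_surj v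
      obtain ⟨x, rfl⟩ := tNet_leaf_iff hD v hv
      unfold tNet
      rw [nd_label]
      exact x.2
    · intro v hv w hw e
      obtain ⟨v, rfl⟩ := nd_surj v
      obtain ⟨w, rfl⟩ := nd_surj w
      obtain ⟨x, rfl⟩ := tNet_leaf_iff hD v hv
      obtain ⟨y, rfl⟩ := tNet_leaf_iff hD w hw
      unfold tNet at e
      rw [nd_label, nd_label] at e
      rw [Subtype.ext (show (x : α) = y from e)]
    · intro x hx
      exact ⟨nd _ _ (.leaf ⟨x, hx⟩), tNet_leaf _, nd_label _⟩
  · unfold Net.reticNum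
    rw [Finset.sum_eq_zero_iff]
    intro v _
    have := tNet_indeg v
    omega

lemma uNet_leaf (x : X) : (uNet X x₀).IsLeaf (nd _ _ (.leaf x)) := by
  apply outdeg_zero
  intro v
  obtain ⟨v, rfl⟩ := nd_surj v
  intro h
  have := nd_adj.1 h
  simp [URel] at this

lemma uNet_leaf_iff (hX : 2 ≤ (Finset.univ : Finset X).card) (v : UV X)
    (h : (uNet X x₀).IsLeaf (nd _ _ v)) : ∃ x, v = .leaf x := by
  unfold Net.IsLeaf at h
  match v, h with
  | .root, h =>
    have := one_le_outdeg (nd_adj.2 (show URel X .root (.cl _ hX) from trivial) :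
      (uNet X x₀).Adj _ _)
    exact absurd h (Nat.one_le_iff_ne_zero.1 this)
  | .cl D hD, h =>
    obtain ⟨d, hd⟩ : D.Nonempty := by rw [← Finset.card_pos]; omega
    have := one_le_outdeg (nd_adj.2 (show URel X (.cl D hD) (.ret d) from hd) :
      (uNet X x₀).Adj _ _)
    exact absurd h (Nat.one_le_iff_ne_zero.1 this)
  | .ret x, h =>
    have := one_le_outdeg (nd_adj.2 (show URel X (.ret x) (.leaf x) from rfl) :
      (uNet X x₀).Adj _ _)
    exact absurd h (Nat.one_le_iff_ne_zero.1 this)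
  | .leaf x, h => exact ⟨x, rfl⟩

lemma uNet_net (hX : 2 ≤ (Finset.univ : Finset X).card) : IsPhyloNet X (uNet X x₀) := by
  refine ⟨?_, ?_, ?_, ?_, ?_⟩
  · refine mk_acyclic (fun v => match v with
      | .root => 0 | .cl _ _ => 1 | .ret _ => 2 | .leaf _ => 3) ?_
    intro u v h
    cases u <;> cases v <;> simp_all [URel]
  · refine ⟨nd _ _ .root, ?_, ?_⟩
    · apply indeg_zero
      intro u h
      obtain ⟨u, rfl⟩ := nd_surj u
      have h := nd_adj.1 h
      cases u <;> simp [URel] at h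
    · intro v hv
      obtain ⟨v, rfl⟩ := nd_surj v
      match v, hv with
      | .root, _ => rfl
      | .cl D hD, hv =>
        exact absurd hv (adj_indeg (N := uNet X x₀)
          (nd_adj.2 (show URel X .root (.cl D hD) from trivial)))
      | .ret x, hv =>
        exact absurd hv (adj_indeg (N := uNet X x₀)
          (nd_adj.2 (show URel X .root (.ret x) from trivial)))
      | .leaf x, hv =>
        exact absurd hv (adj_indeg (N := uNet X x₀)
          (nd_adj.2 (show URel X (.ret x) (.leaf x) from rfl)))
  · rintro v ⟨h1, h2⟩
    obtain ⟨v, rfl⟩ := nd_surj v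
    match v, h1, h2 with
    | .root, h1, h2 =>
      obtain ⟨u, hu⟩ := exists_adj (N := uNet X x₀) (v := nd _ _ .root) (by rw [h1]; simp)
      obtain ⟨u, rfl⟩ := nd_surj u
      have h := nd_adj.1 hu
      cases u <;> simp [URel] at h
    | .cl D hD, h1, h2 =>
      obtain ⟨x, hx, y, hy, hxy⟩ := Finset.one_lt_card.1 hD
      have := two_le_outdeg (N := uNet X x₀)
        (nd_adj.2 (show URel X (.cl D hD) (.ret x) from hx))
        (nd_adj.2 (show URel X (.cl D hD) (.ret y) from hy))
        (fun e => hxy (by simpa using nd_inj e))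
      omega
    | .ret x, h1, h2 =>
      have := two_le_indeg (N := uNet X x₀)
        (nd_adj.2 (show URel X .root (.ret x) from trivial))
        (nd_adj.2 (show URel X (.cl _ hX) (.ret x) from Finset.mem_univ x))
        (fun e => by simpa using nd_inj e)
      omega
    | .leaf x, h1, h2 =>
      have : (uNet X x₀).outdeg _ = 0 := uNet_leaf x
      omega
  · intro v hv
    rw [Nat.succ_le_iff, Nat.pos_iff_ne_zero]
    intro h0
    obtain ⟨v, rfl⟩ := nd_surj v
    obtain ⟨x, rfl⟩ := uNet_leaf_iff hX v h0
    have : (uNet X x₀).indeg (nd _ _ (.leaf x)) ≤ 1 := by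
      apply indeg_le_one
      intro u u' h h'
      obtain ⟨u, rfl⟩ := nd_surj u
      obtain ⟨u', rfl⟩ := nd_surj u'
      have h := nd_adj.1 h
      have h' := nd_adj.1 h'
      have : u = u' := by
        clear * - h h'
        cases u <;> cases u' <;> simp_all [URel]
      rw [this]
    have hv' : 2 ≤ (uNet X x₀).indeg (nd _ _ (.leaf x)) := hv
    omega
  · refine ⟨?_, ?_, ?_⟩
    · intro v hv
      obtain ⟨v, rfl⟩ := nd_surj v
      obtain ⟨x, rfl⟩ := uNet_leaf_iff hX v hv
      unfold uNet
      rw [nd_label]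
      exact x.2
    · intro v hv w hw e
      obtain ⟨v, rfl⟩ := nd_surj v
      obtain ⟨w, rfl⟩ := nd_surj w
      obtain ⟨x, rfl⟩ := uNet_leaf_iff hX v hv
      obtain ⟨y, rfl⟩ := uNet_leaf_iff hX w hw
      unfold uNet at e
      rw [nd_label, nd_label] at e
      rw [Subtype.ext (show (x : α) = y from e)]
    · intro x hx
      exact ⟨nd _ _ (.leaf ⟨x, hx⟩), uNet_leaf _, nd_label _⟩

def emb (D : Finset X) (hD : 2 ≤ D.card) : TV X → UV X
  | .root => .root
  | .c => .cl D hD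
  | .leaf x => .leaf x

def pth (D : Finset X) (hD : 2 ≤ D.card) (u : TV X) : TV X → List (UV X)
  | .leaf x => [emb D hD u, .ret x, .leaf x]
  | v => [emb D hD u, emb D hD v]

lemma emb_inj (hD : 2 ≤ D.card) {u v : TV X} (h : emb D hD u = emb D hD v) : u = v := by
  cases u <;> cases v <;> simp_all [emb]

lemma mem_internals_pth (hD : 2 ≤ D.card) {u v : TV X} {w : UV X}
    (h : w ∈ internals (pth D hD u v)) : ∃ x, v = .leaf x ∧ w = .ret x := by
  cases v <;> simp_all [pth, internals]

lemma internals_map {β γ : Type} (f : β → γ) (l : List β) :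
    internals (l.map f) = (internals l).map f := by
  simp [internals, List.map_tail, List.map_dropLast]

lemma displays (hD : 2 ≤ D.card) : Displays (uNet X x₀) (tNet X x₀ D) := by
  let τ : Fin (tNet X x₀ D).n → TV X := fun i => (Finite.equivFin (TV X)).symm i
  have hτ : ∀ v, τ (nd _ _ v) = v := fun v => by simp [τ, nd]
  let ν : UV X → Fin (uNet X x₀).n := nd _ _
  have hν : Function.Injective ν := fun _ _ h => nd_inj h
  refine ⟨fun i => ν (emb D hD (τ i)), ?_, ?_,
    fun e => (pth D hD (τ e.1) (τ e.2)).map ν, ?_, ?_, ?_⟩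
  · intro i j h
    obtain ⟨u, rfl⟩ := nd_surj i
    obtain ⟨v, rfl⟩ := nd_surj j
    have := emb_inj hD (hν h)
    rw [hτ, hτ] at this
    rw [this]
  · intro i hi
    obtain ⟨v, rfl⟩ := nd_surj i
    obtain ⟨x, rfl⟩ := tNet_leaf_iff hD v hi
    simp only [hτ]
    have e1 := nd_label (R := URel X) (lab := ulab X x₀) (.leaf x)
    have e2 := nd_label (R := TRel X D) (lab := tlab X x₀) (.leaf x)
    exact ⟨uNet_leaf x, e1.trans e2.symm⟩
  · rintro ⟨i, j⟩ he
    obtain ⟨u, rfl⟩ := nd_surj i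
    obtain ⟨v, rfl⟩ := nd_surj j
    have h : TRel X D u v := nd_adj.1 he
    simp only [hτ]
    have hadj : ∀ {a b}, URel X a b → (uNet X x₀).Adj (ν a) (ν b) := fun h => nd_adj.2 h
    match u, v, h with
    | .root, .c, h =>
      exact ⟨rfl, rfl, by simpa [pth, List.Chain', emb] using hadj (by simp [URel]), by simp [pth]⟩
    | .root, .leaf x, h =>
      refine ⟨rfl, rfl, ?_, by simp [pth]⟩
      have h1 := hadj (show URel X .root (.ret x) from trivial)
      have h2 := hadj (show URel X (.ret x) (.leaf x) from rfl)
      simpa [pth, List.Chain', emb] using ⟨h1, h2⟩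
    | .c, .leaf x, h =>
      refine ⟨rfl, rfl, ?_, by simp [pth]⟩
      have h1 := hadj (show URel X (.cl D hD) (.ret x) from h)
      have h2 := hadj (show URel X (.ret x) (.leaf x) from rfl)
      simpa [pth, List.Chain', emb] using ⟨h1, h2⟩
  · rintro ⟨i, j⟩ he w hw ⟨k, rfl⟩
    rw [internals_map, List.mem_map] at hw
    obtain ⟨w, hw, e⟩ := hw
    obtain ⟨x, -, rfl⟩ := mem_internals_pth hD hw
    have := hν e
    generalize τ k = t at this
    cases t <;> simp [emb] at this
  · rintro ⟨i, j⟩ he ⟨i', j'⟩ hf hne w hw hw'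
    rw [internals_map, List.mem_map] at hw hw'
    obtain ⟨w, hw, rfl⟩ := hw
    obtain ⟨w', hw', e⟩ := hw'
    obtain rfl := hν e
    obtain ⟨x, h1, rfl⟩ := mem_internals_pth hD hw
    obtain ⟨y, h2, h3⟩ := mem_internals_pth hD hw'
    obtain rfl : x = y := by simpa using h3
    have hj : j = j' := (Finite.equivFin (TV X)).symm.injective (h1.trans h2.symm)
    subst hj
    exact hne (by rw [adj_unique (tNet_indeg j) he hf])

lemma reaches_leaf (x : X) {w} (h : (tNet X x₀ D).Reaches (nd _ _ (.leaf x)) w) :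
    w = nd _ _ (.leaf x) := by
  rcases Relation.ReflTransGen.cases_head h with e | ⟨v, hv, -⟩
  · exact e.symm
  · obtain ⟨v, rfl⟩ := nd_surj v
    have := nd_adj.1 hv
    simp [TRel] at this

lemma cluster_leaf (x : X) : (tNet X x₀ D).clusterBelow (nd _ _ (.leaf x)) = {(x : α)} := by
  ext y
  simp only [Net.clusterBelow, Finset.mem_image, Finset.mem_filter, Finset.mem_univ, true_and,
    Finset.mem_singleton]
  constructor
  · rintro ⟨w, ⟨h, -⟩, rfl⟩
    rw [reaches_leaf x h]
    exact nd_label _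
  · rintro rfl
    exact ⟨_, ⟨.refl, tNet_leaf x⟩, nd_label _⟩

lemma cluster_c (hD : 2 ≤ D.card) :
    (tNet X x₀ D).clusterBelow (nd _ _ .c) = D.map (Function.Embedding.subtype _) := by
  ext y
  simp only [Net.clusterBelow, Finset.mem_image, Finset.mem_filter, Finset.mem_univ, true_and,
    Finset.mem_map, Function.Embedding.coe_subtype]
  constructor
  · rintro ⟨w, ⟨h, hl⟩, rfl⟩
    obtain ⟨w, rfl⟩ := nd_surj w
    obtain ⟨x, rfl⟩ := tNet_leaf_iff hD w hl
    refine ⟨x, ?_, (nd_label (R := TRel X D) (lab := tlab X x₀) (.leaf x)).symm⟩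
    rcases Relation.ReflTransGen.cases_head h with e | ⟨v, hv, hv2⟩
    · exact absurd (nd_inj e) (by simp)
    · obtain ⟨v, rfl⟩ := nd_surj v
      have h3 := nd_adj.1 hv
      match v, h3 with
      | .leaf z, h3 =>
        have := nd_inj (reaches_leaf z hv2)
        obtain rfl : x = z := by simpa using this
        exact h3
  · rintro ⟨x, hx, rfl⟩
    exact ⟨_, ⟨.single (nd_adj.2 (show TRel X D .c (.leaf x) from hx)), tNet_leaf x⟩, nd_label _⟩

lemma uNet_represents (hX : 2 ≤ (Finset.univ : Finset X).card) {𝒞 : Set (Finset α)}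
    (h𝒞 : IsClusterSet X 𝒞) : RepresentsSet X (uNet X x₀) 𝒞 := by
  intro C hC
  obtain ⟨h1, h2, -⟩ := h𝒞 C hC
  by_cases hc : 2 ≤ C.card
  · have e : (C.subtype (· ∈ X)).map (Function.Embedding.subtype _) = C :=
      Finset.subtype_map_of_mem h1
    have hD : 2 ≤ (C.subtype (· ∈ X)).card := by
      rw [← e, Finset.card_map] at hc; exact hc
    refine ⟨tNet X x₀ (C.subtype (· ∈ X)), tNet_tree hD, displays hD,
      (nd _ _ .root, nd _ _ .c), nd_adj.2 (by simp [TRel]), ?_⟩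
    exact (cluster_c hD).trans e
  · have : C.card = 1 := by
      have := Finset.card_pos.2 h2
      omega
    obtain ⟨x, rfl⟩ := Finset.card_eq_one.1 this
    have hx : x ∈ X := h1 (by simp)
    exact ⟨tNet X x₀ Finset.univ, tNet_tree hX, displays hX,
      (nd _ _ .c, nd _ _ (.leaf ⟨x, hx⟩)), nd_adj.2 (by simp [TRel]), cluster_leaf ⟨x, hx⟩⟩

end

/-- MST lower bound.  Given a set of clusters `𝒞` on `X`, there exists
a maximal ST-set tree sequence `(S₁, …, S_p)` of `𝒞` with `p ≤ r(𝒞)`. -/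
theorem exists_maxST_tree_seq_le_rNum {α : Type} [DecidableEq α] (X : Finset α)
    (𝒞 : Set (Finset α)) (h𝒞 : IsClusterSet X 𝒞) :
    ∃ L : List (Finset α), IsMaxSTTreeSeq X 𝒞 L ∧ L.length ≤ rNum X 𝒞 := by
  by_cases hX : 2 ≤ X.card
  · obtain ⟨x₀, -⟩ : X.Nonempty := by rw [← Finset.card_pos]; omega
    have hX' : 2 ≤ (Finset.univ : Finset X).card := by simpa using hX
    have hne : {k | ∃ N : Net α, IsPhyloNet X N ∧ RepresentsSet X N 𝒞 ∧ N.reticNum = k}.Nonempty :=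
      ⟨_, uNet X x₀, uNet_net hX', uNet_represents hX' h𝒞, rfl⟩
    obtain ⟨N, hN, hR, hk⟩ := Nat.sInf_mem hne
    obtain ⟨L, hL, hlen⟩ := exists_seq_of_net h𝒞 hN hR
    exact ⟨L, hL, by rw [hk] at hlen; exact hlen⟩
  · refine ⟨[], ⟨trivial, ?_⟩, Nat.zero_le _⟩
    intro A hA
    obtain ⟨h1, h2, h3⟩ := h𝒞 A hA
    have := Finset.card_lt_card (h1.ssubset_of_ne h3)
    have := Finset.card_pos.2 h2
    omega

end Phylo
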